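/- The number of pairs (τ₁, τ₂) of partial permutation matrices of size n such that the 2n×n matrix ω = (τ₁; τ₂) (stacking τ₁ over τ₂) has rank n, counted up to the right action of the symmetric group Sₙ (permuting columns), equals the sum over all decompositions n = r + p + q of r! · (n! / (r! p! q!))². -/

import Mathlib

open Matrix

/-- A partial permutation matrix: entries in `{0,1}`, at most one `1` in each row
and each column. -/
def IsPartialPerm {n : ℕ} (τ : Matrix (Fin n) (Fin n) ℂ) : Prop :=
  (∀ i j, τ i j = 0 ∨ τ i j = 1) ∧
  (∀ i j j', τ i j = 1 → τ i j' = 1 → j = j') ∧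
  (∀ i i' j, τ i j = 1 → τ i' j = 1 → i = i')

/-- Pairs `(τ₁, τ₂)` of partial permutation matrices whose stacked `2n × n`
matrix has full rank `n`. -/
def FullRankPairs (n : ℕ) : Type :=
  {ω : Matrix (Fin n) (Fin n) ℂ × Matrix (Fin n) (Fin n) ℂ //
    IsPartialPerm ω.1 ∧ IsPartialPerm ω.2 ∧ (Matrix.fromRows ω.1 ω.2).rank = n}

/-- The right action of `Sₙ` by simultaneous column permutation. -/
def ppRel (n : ℕ) (a b : FullRankPairs n) : Prop :=
  ∃ s : Equiv.Perm (Fin n),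
    b.val.1 = a.val.1 * s.permMatrix ℂ ∧ b.val.2 = a.val.2 * s.permMatrix ℂ

namespace IsPartialPerm

variable {n : ℕ} {τ τ₁ τ₂ : Matrix (Fin n) (Fin n) ℂ}

theorem ne_zero_iff (h : IsPartialPerm τ) (i j : Fin n) : τ i j ≠ 0 ↔ τ i j = 1 := by
  rcases h.1 i j with h | h <;> simp [h]

theorem mulVec_apply (h : IsPartialPerm τ) (v : Fin n → ℂ) {i j : Fin n} (hij : τ i j = 1) :
    (τ *ᵥ v) i = v j := by
  rw [Matrix.mulVec_eq_sum, Finset.sum_apply, Finset.sum_eq_single j]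
  · simp [hij]
  · intro k _ hk
    have : τ i k = 0 := by
      by_contra hne
      exact hk (h.2.1 i k j ((h.ne_zero_iff i k).1 hne) hij)
    simp [this]
  · simp

theorem rank_fromRows_eq_iff (h₁ : IsPartialPerm τ₁) (h₂ : IsPartialPerm τ₂) :
    (Matrix.fromRows τ₁ τ₂).rank = n ↔ ∀ j, (∃ i, τ₁ i j = 1) ∨ (∃ i, τ₂ i j = 1) := by
  have key : (Matrix.fromRows τ₁ τ₂).rank = n ↔
      LinearIndependent ℂ (Matrix.fromRows τ₁ τ₂).col := by
    rw [linearIndependent_iff_card_eq_finrank_span, Matrix.rank_eq_finrank_span_cols,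
      Fintype.card_fin, Set.finrank, eq_comm]
  rw [key]
  constructor
  · intro hli j
    by_contra! hj
    refine hli.ne_zero j ?_
    ext (i | i)
    · exact by_contra fun hne ↦ hj.1 i ((h₁.ne_zero_iff i j).1 hne)
    · exact by_contra fun hne ↦ hj.2 i ((h₂.ne_zero_iff i j).1 hne)
  · intro hcol
    rw [← Matrix.mulVec_injective_iff]
    intro v w hvw
    simp only [Matrix.fromRows_mulVec] at hvw
    ext j
    rcases hcol j with ⟨i, hi⟩ | ⟨i, hi⟩
    · have := congrFun hvw (Sum.inl i)
      simpa [h₁.mulVec_apply _ hi] using this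
    · have := congrFun hvw (Sum.inr i)
      simpa [h₂.mulVec_apply _ hi] using this

theorem submatrix_perm (h : IsPartialPerm τ) (s : Equiv.Perm (Fin n)) :
    IsPartialPerm (τ.submatrix id s) :=
  ⟨fun i j ↦ h.1 i (s j), fun i _ _ hj hj' ↦ s.injective (h.2.1 i _ _ hj hj'),
    fun i i' _ hi hi' ↦ h.2.2 i i' _ hi hi'⟩

end IsPartialPerm

section PartialPermOfEmbedding

variable {n : ℕ}

open Classical in
/-- The partial permutation matrix whose nonzero columns are those in `A`, the `1` in column
`j ∈ A` being in row `f j`. -/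
noncomputable def partialPermMatrix (x : Σ A : Finset (Fin n), (A ↪ Fin n)) :
    Matrix (Fin n) (Fin n) ℂ :=
  Matrix.of fun i j ↦ if ∃ h : j ∈ x.1, x.2 ⟨j, h⟩ = i then 1 else 0

theorem partialPermMatrix_eq_one_iff (x : Σ A : Finset (Fin n), (A ↪ Fin n)) (i j : Fin n) :
    partialPermMatrix x i j = 1 ↔ ∃ h : j ∈ x.1, x.2 ⟨j, h⟩ = i := by
  simp [partialPermMatrix]

theorem exists_partialPermMatrix_eq_one_iff (x : Σ A : Finset (Fin n), (A ↪ Fin n))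
    (j : Fin n) : (∃ i, partialPermMatrix x i j = 1) ↔ j ∈ x.1 := by
  simp [partialPermMatrix_eq_one_iff]

theorem isPartialPerm_partialPermMatrix (x : Σ A : Finset (Fin n), (A ↪ Fin n)) :
    IsPartialPerm (partialPermMatrix x) := by
  refine ⟨fun i j ↦ ?_, fun i _ _ hj hj' ↦ ?_, fun i i' _ hi hi' ↦ ?_⟩
  · simp only [partialPermMatrix, Matrix.of_apply]
    split_ifs <;> simp
  · obtain ⟨h, rfl⟩ := (partialPermMatrix_eq_one_iff _ _ _).1 hj
    obtain ⟨h', he⟩ := (partialPermMatrix_eq_one_iff _ _ _).1 hj'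
    simpa using (x.2.injective he).symm
  · obtain ⟨h, rfl⟩ := (partialPermMatrix_eq_one_iff _ _ _).1 hi
    obtain ⟨h', rfl⟩ := (partialPermMatrix_eq_one_iff _ _ _).1 hi'
    rfl

theorem partialPermMatrix_injective :
    Function.Injective (partialPermMatrix : (Σ A : Finset (Fin n), (A ↪ Fin n)) → _) := by
  rintro ⟨A, f⟩ ⟨B, g⟩ h
  obtain rfl : A = B := by
    ext j
    rw [← exists_partialPermMatrix_eq_one_iff ⟨A, f⟩ j,
      ← exists_partialPermMatrix_eq_one_iff ⟨B, g⟩ j, h]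
  congr 1
  ext1 j
  have h₁ : partialPermMatrix ⟨A, f⟩ (f j) j = 1 :=
    (partialPermMatrix_eq_one_iff _ _ _).2 ⟨j.2, rfl⟩
  rw [h] at h₁
  obtain ⟨_, hj⟩ := (partialPermMatrix_eq_one_iff _ _ _).1 h₁
  exact hj.symm

theorem exists_partialPermMatrix_eq {τ : Matrix (Fin n) (Fin n) ℂ} (h : IsPartialPerm τ) :
    ∃ x, partialPermMatrix x = τ := by
  classical
  let A : Finset (Fin n) := Finset.univ.filter fun j ↦ ∃ i, τ i j = 1
  have mem_A (j : Fin n) : j ∈ A ↔ ∃ i, τ i j = 1 := by simp [A]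
  have hA (j : A) : ∃ i, τ i j = 1 := (mem_A j).1 j.2
  choose f hf using hA
  refine ⟨⟨A, f, fun j j' hjj' ↦ ?_⟩, ?_⟩
  · exact Subtype.ext (h.2.1 (f j) j j' (hf j) (hjj' ▸ hf j'))
  · ext i j
    by_cases hij : τ i j = 1
    · rw [hij, partialPermMatrix_eq_one_iff]
      have hj : j ∈ A := (mem_A j).2 ⟨i, hij⟩
      exact ⟨hj, h.2.2 _ _ _ (hf ⟨j, hj⟩) hij⟩
    · rw [(h.1 i j).resolve_right hij]
      by_contra hne
      rw [← ne_eq, (isPartialPerm_partialPermMatrix _).ne_zero_iff, partialPermMatrix_eq_one_iff] at hne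
      obtain ⟨hj, rfl⟩ := hne
      exact hij (hf ⟨j, hj⟩)

end PartialPermOfEmbedding

namespace FullRankPairs

variable {n : ℕ}

theorem exists_eq_one (a : FullRankPairs n) (j : Fin n) :
    (∃ i, a.val.1 i j = 1) ∨ (∃ i, a.val.2 i j = 1) :=
  (a.2.1.rank_fromRows_eq_iff a.2.2.1).1 a.2.2.2 j

instance : MulAction (Equiv.Perm (Fin n)) (FullRankPairs n) where
  smul s a := ⟨(a.val.1.submatrix id s.symm, a.val.2.submatrix id s.symm),
    a.2.1.submatrix_perm _, a.2.2.1.submatrix_perm _,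
    ((a.2.1.submatrix_perm _).rank_fromRows_eq_iff (a.2.2.1.submatrix_perm _)).2
      fun j ↦ a.exists_eq_one (s.symm j)⟩
  one_smul _ := rfl
  mul_smul _ _ _ := rfl

theorem smul_val (s : Equiv.Perm (Fin n)) (a : FullRankPairs n) :
    (s • a).val = (a.val.1 * s.permMatrix ℂ, a.val.2 * s.permMatrix ℂ) := by
  simp only [Equiv.Perm.permMatrix, PEquiv.mul_toMatrix_toPEquiv]
  rfl

theorem stabilizer_eq_bot (a : FullRankPairs n) :
    MulAction.stabilizer (Equiv.Perm (Fin n)) a = ⊥ := by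
  rw [eq_bot_iff]
  intro s hs
  rw [MulAction.mem_stabilizer_iff] at hs
  rw [Subgroup.mem_bot]
  ext1 j
  have h₁ (i) : a.val.1 i j = a.val.1 i (s j) := by
    conv_rhs => rw [← hs]
    exact congrArg (a.val.1 i) (s.symm_apply_apply j).symm
  have h₂ (i) : a.val.2 i j = a.val.2 i (s j) := by
    conv_rhs => rw [← hs]
    exact congrArg (a.val.2 i) (s.symm_apply_apply j).symm
  rcases a.exists_eq_one j with ⟨i, hi⟩ | ⟨i, hi⟩
  · exact a.2.1.2.1 i _ _ ((h₁ i).symm.trans hi) hi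
  · exact a.2.2.1.2.1 i _ _ ((h₂ i).symm.trans hi) hi

theorem ppRel_iff (a b : FullRankPairs n) :
    ppRel n a b ↔ MulAction.orbitRel (Equiv.Perm (Fin n)) (FullRankPairs n) b a := by
  rw [MulAction.orbitRel_apply, MulAction.mem_orbit_iff]
  refine exists_congr fun s ↦ ?_
  constructor
  · exact fun h ↦ Subtype.ext ((smul_val s a).trans (Prod.ext h.1.symm h.2.symm))
  · rintro rfl
    exact ⟨congrArg Prod.fst (smul_val s a), congrArg Prod.snd (smul_val s a)⟩

theorem card_eq_card_quot_mul_factorial :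
    Nat.card (FullRankPairs n) = Nat.card (Quot (ppRel n)) * n.factorial := by
  have e : Quot (ppRel n) ≃
      Quotient (MulAction.orbitRel (Equiv.Perm (Fin n)) (FullRankPairs n)) :=
    Quot.congrRight fun a b ↦ (ppRel_iff a b).trans (Setoid.comm' _)
  rw [Nat.card_congr (MulAction.selfEquivOrbitsQuotientProd
    (stabilizer_eq_bot (n := n))), Nat.card_prod, Nat.card_congr e, Nat.card_perm, Nat.card_fin]

/-- Full-rank pairs correspond to pairs of embeddings whose domains cover `Fin n`. -/
noncomputable def equivEmbeddings :
    {x : (Σ A : Finset (Fin n), (A ↪ Fin n)) × (Σ A : Finset (Fin n), (A ↪ Fin n)) //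
      x.2.1ᶜ ⊆ x.1.1} ≃ FullRankPairs n :=
  have hcover (A B : Finset (Fin n)) : Bᶜ ⊆ A ↔ ∀ j, j ∈ A ∨ j ∈ B := by
    simp only [Finset.subset_iff, Finset.mem_compl]
    exact forall_congr' fun j ↦ by tauto
  Equiv.ofBijective
    (fun x ↦ ⟨(partialPermMatrix x.1.1, partialPermMatrix x.1.2),
      isPartialPerm_partialPermMatrix _, isPartialPerm_partialPermMatrix _, by
        rw [(isPartialPerm_partialPermMatrix _).rank_fromRows_eq_iff
          (isPartialPerm_partialPermMatrix _)]
        simpa only [exists_partialPermMatrix_eq_one_iff, hcover] using x.2⟩) <| by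
    constructor
    · rintro ⟨⟨x, y⟩, h⟩ ⟨⟨x', y'⟩, h'⟩ hxy
      have := Prod.ext_iff.1 (Subtype.ext_iff.1 hxy)
      exact Subtype.ext (Prod.ext (partialPermMatrix_injective this.1)
        (partialPermMatrix_injective this.2))
    · intro a
      obtain ⟨x, hx⟩ := exists_partialPermMatrix_eq a.2.1
      obtain ⟨y, hy⟩ := exists_partialPermMatrix_eq a.2.2.1
      refine ⟨⟨(x, y), ?_⟩, Subtype.ext (Prod.ext hx hy)⟩
      have := a.exists_eq_one
      rw [← hx, ← hy] at this
      simpa only [exists_partialPermMatrix_eq_one_iff, ← hcover] using this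

theorem card_eq_sum_finset :
    Nat.card (FullRankPairs n) = ∑ A : Finset (Fin n), ∑ P ∈ A.powerset,
      n.descFactorial A.card * n.descFactorial (n - P.card) := by
  classical
  calc Nat.card (FullRankPairs n)
    _ = ∑ A : Finset (Fin n), ∑ _f : A ↪ Fin n, ∑ B : Finset (Fin n), ∑ _g : B ↪ Fin n,
        if Bᶜ ⊆ A then 1 else 0 := by
      rw [← Nat.card_congr equivEmbeddings, Nat.card_eq_fintype_card, Fintype.card_subtype,
        Finset.card_filter, Fintype.sum_prod_type, Fintype.sum_sigma]
      simp_rw [Fintype.sum_sigma]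
    _ = _ := by
      refine Finset.sum_congr rfl fun A _ ↦ ?_
      have hA : (Finset.univ.filter (· ⊆ A)) = A.powerset := by ext; simp
      simp only [Finset.sum_const, Finset.card_univ, Fintype.card_embedding_eq, Fintype.card_coe,
        Fintype.card_fin, smul_eq_mul]
      rw [← hA, Finset.sum_filter,
        ← Equiv.sum_comp ((compl_involutive (α := Finset (Fin n))).toPerm Compl.compl)]
      simp [Finset.card_compl, Finset.mul_sum]

theorem card_eq_sum_choose :
    Nat.card (FullRankPairs n) = ∑ a ∈ Finset.range (n + 1), ∑ p ∈ Finset.range (a + 1),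
      n.choose a * (a.choose p * (n.descFactorial a * n.descFactorial (n - p))) := by
  rw [card_eq_sum_finset, ← Finset.powerset_univ]
  rw [Finset.sum_congr rfl fun A _ ↦ Finset.sum_powerset_apply_card
      (fun k ↦ n.descFactorial A.card * n.descFactorial (n - k)),
    Finset.sum_powerset_apply_card fun a ↦ ∑ p ∈ Finset.range (a + 1),
    a.choose p • (n.descFactorial a * n.descFactorial (n - p))]
  simp [Finset.mul_sum]

end FullRankPairs

theorem Finset.sum_range_sum_range_succ_eq {M : Type*} [AddCommMonoid M] (n : ℕ)
    (f : ℕ → ℕ → M) :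
    ∑ a ∈ Finset.range (n + 1), ∑ p ∈ Finset.range (a + 1), f a p =
      ∑ r ∈ Finset.range (n + 1), ∑ p ∈ Finset.range (n + 1 - r), f (r + p) p := by
  rw [Finset.sum_sigma', Finset.sum_sigma']
  refine Finset.sum_nbij' (fun x ↦ ⟨x.1 - x.2, x.2⟩) (fun x ↦ ⟨x.1 + x.2, x.2⟩) ?_ ?_ ?_ ?_ ?_
  · rintro ⟨a, p⟩ h
    simp only [Finset.mem_sigma, Finset.mem_range] at h ⊢
    omega
  · rintro ⟨a, p⟩ h
    simp only [Finset.mem_sigma, Finset.mem_range] at h ⊢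
    omega
  · rintro ⟨a, p⟩ h
    simp only [Finset.mem_sigma, Finset.mem_range] at h
    simp only [Sigma.mk.injEq, heq_eq_eq, and_true]
    omega
  · rintro ⟨a, p⟩ h
    simp
  · rintro ⟨a, p⟩ h
    simp only [Finset.mem_sigma, Finset.mem_range] at h
    exact congrArg (f · p) (Nat.sub_add_cancel (show p ≤ a by omega)).symm

theorem choose_mul_choose_mul_descFactorial_eq (r p q : ℕ) :
    (r + p + q).choose (r + p) * ((r + p).choose p *
      ((r + p + q).descFactorial (r + p) * (r + p + q).descFactorial (r + q))) =
    r.factorial * ((r + p + q).factorial / (r.factorial * p.factorial * q.factorial)) ^ 2 *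
      (r + p + q).factorial := by
  have h₁ := Nat.choose_mul_factorial_mul_factorial (n := r + p + q) (k := r + p) (by omega)
  have h₂ := Nat.choose_mul_factorial_mul_factorial (n := r + p) (k := p) (by omega)
  have h₃ := Nat.factorial_mul_descFactorial (n := r + p + q) (k := r + p) (by omega)
  have h₄ := Nat.factorial_mul_descFactorial (n := r + p + q) (k := r + q) (by omega)
  rw [show r + p + q - (r + p) = q by omega] at h₁ h₃
  rw [show r + p - p = r by omega] at h₂
  rw [show r + p + q - (r + q) = p by omega] at h₄
  have h₅ : (r + p + q).factorial / (r.factorial * p.factorial * q.factorial) =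
      (r + p + q).choose (r + p) * (r + p).choose p := by
    refine Nat.div_eq_of_eq_mul_left (by positivity) ?_
    rw [← h₁, ← h₂]
    ring
  rw [h₅]
  have hp := p.factorial_pos
  have hq := q.factorial_pos
  refine Nat.eq_of_mul_eq_mul_left (Nat.mul_pos hp hq) ?_
  set D := (r + p + q).descFactorial (r + p)
  set E := (r + p + q).descFactorial (r + q)
  set C := (r + p + q).choose (r + p)
  set B := (r + p).choose p
  calc _ = C * B * (q.factorial * D) * (p.factorial * E) := by ring
    _ = C * B * (C * (B * p.factorial * r.factorial) * q.factorial) * (r + p + q).factorial := by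
      rw [h₃, h₄, h₂, h₁]
    _ = _ := by ring

theorem count_full_rank_pairs_mod_Sn (n : ℕ) :
    Nat.card (Quot (ppRel n)) =
      ∑ r ∈ Finset.range (n + 1), ∑ p ∈ Finset.range (n + 1 - r),
        r.factorial *
          (n.factorial /
            (r.factorial * p.factorial * (n - r - p).factorial)) ^ 2 := by
  refine Nat.eq_of_mul_eq_mul_right n.factorial_pos ?_
  rw [← FullRankPairs.card_eq_card_quot_mul_factorial, FullRankPairs.card_eq_sum_choose,
    Finset.sum_range_sum_range_succ_eq]
  simp_rw [Finset.sum_mul]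
  refine Finset.sum_congr rfl fun r hr ↦ Finset.sum_congr rfl fun p hp ↦ ?_
  rw [Finset.mem_range] at hr hp
  obtain ⟨q, rfl⟩ : ∃ q, n = r + p + q := ⟨n - r - p, by omega⟩
  rw [show r + p + q - r - p = q by omega, show r + p + q - p = r + q by omega]
  exact choose_mul_choose_mul_descFactorial_eq r p q
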